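/- arXiv:1412.4971 — 13 statements merged into one kernel-verified Lean document; each statement's English description precedes it below -/
import Mathlib

section
/- Let $c \in \mathbb{R}$, let $n > 0$, and let $J$ be an open interval on which $X(x) := x(1+cx) > 0$ and $X'(x) = 1+2cx > 0$. Suppose $S : J \to \mathbb{R}$ is twice differentiable, strictly positive, and satisfies the differential equation $X(x)X'(x)S''(x) + (4(n+c)X(x)+1)S'(x) + 2nX'(x)S(x) = 0$ on $J$. Then $\log S$ is convex on $J$ if and only if for every $x \in J$, $z_1(x) \le S'(x)/S(x) \le z_2(x)$, where $z_1(x) = \frac{-\sqrt{(1+4cX(x))^2+(4nX(x))^2}-(1+4cX(x))-4nX(x)}{2X(x)X'(x)}$ and $z_2(x) = \frac{\sqrt{(1+4cX(x))^2+(4nX(x))^2}-(1+4cX(x))-4nX(x)}{2X(x)X'(x)}$. -/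
open Real Set

/-- A quadratic with positive leading coefficient and nonnegative discriminant `d` is nonpositive
exactly between its two roots. -/
lemma quadratic_nonpos_iff_between_roots {p q r d y : ℝ} (hp : 0 < p) (hd : 0 ≤ d)
    (h : q ^ 2 - 4 * p * r = d) :
    p * y ^ 2 + q * y + r ≤ 0 ↔
      (-√d - q) / (2 * p) ≤ y ∧ y ≤ (√d - q) / (2 * p) := by
  have key : p * y ^ 2 + q * y + r ≤ 0 ↔ (2 * p * y + q) ^ 2 ≤ d := by
    have e : (2 * p * y + q) ^ 2 - d = 4 * p * (p * y ^ 2 + q * y + r) := by rw [← h]; ring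
    rw [← sub_nonpos (b := d), e, mul_nonpos_iff_pos_imp_nonpos]
    exact ⟨fun h => ⟨fun _ => h, fun _ => by positivity⟩, fun h => h.1 (by positivity)⟩
  rw [key, ← Real.sqrt_le_sqrt_iff hd, Real.sqrt_sq_eq_abs, abs_le, div_le_iff₀ (by positivity),
    le_div_iff₀ (by positivity)]
  constructor <;> rintro ⟨h₁, h₂⟩ <;> constructor <;> linarith

/-- A twice differentiable function on an open interval is convex iff its second derivative is
nonnegative. -/
lemma convexOn_Ioo_iff_deriv2_nonneg {a b : ℝ} {f f' f'' : ℝ → ℝ}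
    (hf : ∀ x ∈ Ioo a b, HasDerivAt f (f' x) x)
    (hf' : ∀ x ∈ Ioo a b, HasDerivAt f' (f'' x) x) :
    ConvexOn ℝ (Ioo a b) f ↔ ∀ x ∈ Ioo a b, 0 ≤ f'' x := by
  have hd : ∀ x ∈ Ioo a b, HasDerivAt (deriv f) (f'' x) x := fun x hx =>
    (hf' x hx).congr_of_eventuallyEq <| by
      filter_upwards [isOpen_Ioo.mem_nhds hx] with y hy using (hf y hy).deriv
  constructor
  · intro hc x hx
    have hm := (hc.monotoneOn_deriv fun y hy => (hf y hy).differentiableAt).derivWithin_nonneg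
      (x := x)
    rwa [derivWithin_of_isOpen isOpen_Ioo hx, (hd x hx).deriv] at hm
  · intro h
    refine convexOn_of_deriv2_nonneg' (convex_Ioo a b)
      (fun x hx => (hf x hx).differentiableAt.differentiableWithinAt)
      (fun x hx => (hd x hx).differentiableAt.differentiableWithinAt) fun x hx => ?_
    simpa [(hd x hx).deriv] using h x hx

/-- Let `c ∈ ℝ`, `n > 0`, and let `J = (a,b)` be an open interval on which
`X x = x(1+cx) > 0` and `X' x = 1+2cx > 0`. If `S` is twice differentiable and strictly
positive on `J` and satisfies `X X' S'' + (4(n+c)X+1)S' + 2nX'S = 0`, then `log S` is convex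
on `J` iff `z₁ x ≤ S'(x)/S(x) ≤ z₂ x` for all `x ∈ J`. -/
theorem renyi_logconvex_iff_between (c n a b : ℝ) (hn : 0 < n) (S : ℝ → ℝ)
    (hX : ∀ x ∈ Ioo a b, 0 < x * (1 + c * x))
    (hX' : ∀ x ∈ Ioo a b, 0 < 1 + 2 * c * x)
    (hSpos : ∀ x ∈ Ioo a b, 0 < S x)
    (hS1 : ∀ x ∈ Ioo a b, DifferentiableAt ℝ S x)
    (hS2 : ∀ x ∈ Ioo a b, DifferentiableAt ℝ (deriv S) x)
    (hODE : ∀ x ∈ Ioo a b,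
      (x * (1 + c * x)) * (1 + 2 * c * x) * deriv (deriv S) x
        + (4 * (n + c) * (x * (1 + c * x)) + 1) * deriv S x
        + 2 * n * (1 + 2 * c * x) * S x = 0) :
    ConvexOn ℝ (Ioo a b) (fun x => Real.log (S x)) ↔
      ∀ x ∈ Ioo a b,
        (-Real.sqrt ((1 + 4 * c * (x * (1 + c * x)))^2 + (4 * n * (x * (1 + c * x)))^2)
            - (1 + 4 * c * (x * (1 + c * x))) - 4 * n * (x * (1 + c * x)))
          / (2 * (x * (1 + c * x)) * (1 + 2 * c * x)) ≤ deriv S x / S x ∧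
        deriv S x / S x ≤
          (Real.sqrt ((1 + 4 * c * (x * (1 + c * x)))^2 + (4 * n * (x * (1 + c * x)))^2)
            - (1 + 4 * c * (x * (1 + c * x))) - 4 * n * (x * (1 + c * x)))
          / (2 * (x * (1 + c * x)) * (1 + 2 * c * x)) := by
  have hconv := convexOn_Ioo_iff_deriv2_nonneg
    (fun x hx => (hS1 x hx).hasDerivAt.log (hSpos x hx).ne')
    (fun x hx => (hS2 x hx).hasDerivAt.div (hS1 x hx).hasDerivAt (hSpos x hx).ne')
  rw [hconv]
  refine forall₂_congr fun x hx => ?_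
  have hs := hSpos x hx
  have hA : 0 < x * (1 + c * x) * (1 + 2 * c * x) := mul_pos (hX x hx) (hX' x hx)
  have hquad := quadratic_nonpos_iff_between_roots (y := deriv S x / S x)
    (q := 1 + 4 * c * (x * (1 + c * x)) + 4 * n * (x * (1 + c * x)))
    (r := 2 * n * (1 + 2 * c * x))
    (d := (1 + 4 * c * (x * (1 + c * x))) ^ 2 + (4 * n * (x * (1 + c * x))) ^ 2)
    hA (by positivity) (by ring)
  simp only [← sub_sub, ← mul_assoc] at hquad ⊢
  rw [← hquad]
  have e : x * (1 + c * x) * (1 + 2 * c * x) *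
      ((deriv (deriv S) x * S x - deriv S x * deriv S x) / S x ^ 2) =
      -(x * (1 + c * x) * (1 + 2 * c * x) * (deriv S x / S x) ^ 2
        + (1 + 4 * c * (x * (1 + c * x)) + 4 * n * (x * (1 + c * x))) * (deriv S x / S x)
        + 2 * n * (1 + 2 * c * x)) := by
    field_simp
    linear_combination S x * hODE x hx
  rw [← mul_nonneg_iff_of_pos_left hA, e, neg_nonneg]
  simp only [← mul_assoc]
end

section
/- Let $n$ be a positive integer and assume that $\log K_n$ is convex on $(0,\infty)$. Then for every $t > 0$, $\frac{-\sqrt{1+(4nt)^2}-1-4nt}{2t} \le \frac{K_n'(t)}{K_n(t)} \le \frac{\sqrt{1+(4nt)^2}-1-4nt}{2t}$. -/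
open Real Set

/-- `K n x = e^{-2nx} ∑_{k≥0} (nx)^{2k}/(k!)²`, the sum of the squares of the
Szász–Mirakyan basis functions. -/
noncomputable def szaszK (n : ℕ) (x : ℝ) : ℝ :=
  Real.exp (-2 * n * x) * ∑' k : ℕ, ((n : ℝ) * x) ^ (2 * k) / (Nat.factorial k : ℝ) ^ 2

/-- The entire series `∑ s^k / (k! (k+m)!)`, a rescaled modified Bessel function. -/
noncomputable def besselSeries (m : ℕ) (s : ℝ) : ℝ :=
  ∑' k : ℕ, s ^ k / ((k.factorial : ℝ) * (k + m).factorial)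

lemma pow_div_factorial_mul_factorial_le (m k : ℕ) {r : ℝ} (hr : 0 ≤ r) :
    r ^ k / ((k.factorial : ℝ) * (k + m).factorial) ≤ r ^ k / k.factorial := by
  have h : (1 : ℝ) ≤ (k + m).factorial := by
    exact_mod_cast Nat.one_le_iff_ne_zero.mpr (Nat.factorial_ne_zero _)
  gcongr
  exact le_mul_of_one_le_right (by positivity) h

lemma summable_besselSeries (m : ℕ) (s : ℝ) :
    Summable fun k : ℕ => s ^ k / ((k.factorial : ℝ) * (k + m).factorial) := by
  refine .of_norm_bounded (Real.summable_pow_div_factorial |s|) fun k => ?_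
  rw [norm_div, norm_pow, Real.norm_eq_abs s, Real.norm_of_nonneg (by positivity)]
  exact pow_div_factorial_mul_factorial_le m k (abs_nonneg s)

lemma succ_mul_pow_div_factorial_mul_factorial (m k : ℕ) (s : ℝ) :
    (k + 1 : ℕ) * s ^ k / (((k + 1).factorial : ℝ) * (k + 1 + m).factorial)
      = s ^ k / ((k.factorial : ℝ) * (k + (m + 1)).factorial) := by
  rw [show k + 1 + m = k + (m + 1) by ring, Nat.factorial_succ k]
  push_cast
  have : (k : ℝ) + 1 ≠ 0 := by positivity
  field_simp

lemma hasDerivAt_besselSeries (m : ℕ) (s : ℝ) :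
    HasDerivAt (besselSeries m) (besselSeries (m + 1) s) s := by
  set r := |s| + 1
  have hu : Summable fun k : ℕ =>
      (k : ℝ) * r ^ (k - 1) / ((k.factorial : ℝ) * (k + m).factorial) := by
    rw [← summable_nat_add_iff 1]
    simpa only [Nat.add_sub_cancel, succ_mul_pow_div_factorial_mul_factorial]
      using summable_besselSeries (m + 1) r
  have hd := hasDerivAt_tsum_of_isPreconnected (t := Metric.ball (0 : ℝ) r)
    (g := fun (k : ℕ) y => y ^ k / ((k.factorial : ℝ) * (k + m).factorial))
    (g' := fun (k : ℕ) y => (k : ℝ) * y ^ (k - 1) / ((k.factorial : ℝ) * (k + m).factorial))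
    hu Metric.isOpen_ball (convex_ball _ _).isPreconnected
    (fun k y _ => (hasDerivAt_pow k y).div_const _)
    (fun k y hy => by
      rw [norm_div, norm_mul, norm_pow, Real.norm_of_nonneg (Nat.cast_nonneg k),
        Real.norm_of_nonneg (by positivity : (0 : ℝ) ≤ k.factorial * (k + m).factorial)]
      have := (mem_ball_zero_iff.mp hy).le
      gcongr)
    (y₀ := s) (y := s) (by simp [r]) (summable_besselSeries m s) (by simp [r])
  refine hd.congr_deriv ?_
  rw [tsum_eq_zero_add']
  · simp only [Nat.add_sub_cancel, succ_mul_pow_div_factorial_mul_factorial]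
    simp [besselSeries]
  · simpa only [Nat.add_sub_cancel, succ_mul_pow_div_factorial_mul_factorial]
      using summable_besselSeries (m + 1) s

lemma besselSeries_recurrence (m : ℕ) (s : ℝ) :
    s * besselSeries (m + 2) s + (m + 1) * besselSeries (m + 1) s = besselSeries m s := by
  have hs : Summable fun k : ℕ =>
      (k : ℝ) * (s ^ k / ((k.factorial : ℝ) * (k + (m + 1)).factorial)) := by
    rw [← summable_nat_add_iff 1]
    refine ((summable_besselSeries (m + 2) s).mul_left s).congr fun k => ?_
    rw [← succ_mul_pow_div_factorial_mul_factorial (m + 1)]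
    ring
  have h₁ : s * besselSeries (m + 2) s =
      ∑' k : ℕ, (k : ℝ) * (s ^ k / ((k.factorial : ℝ) * (k + (m + 1)).factorial)) := by
    rw [hs.tsum_eq_zero_add, besselSeries, ← tsum_mul_left]
    simp only [Nat.cast_zero, zero_mul, zero_add]
    refine tsum_congr fun k => ?_
    rw [← succ_mul_pow_div_factorial_mul_factorial (m + 1)]
    ring
  rw [h₁, besselSeries, ← tsum_mul_left,
    ← hs.tsum_add ((summable_besselSeries (m + 1) s).mul_left _), besselSeries]
  refine tsum_congr fun k => ?_
  rw [← add_assoc k m 1, Nat.factorial_succ (k + m)]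
  push_cast
  have : (k : ℝ) + m + 1 ≠ 0 := by positivity
  field_simp
  ring

lemma szaszK_eq_exp_mul_besselSeries (n : ℕ) (x : ℝ) :
    szaszK n x = Real.exp (-2 * n * x) * besselSeries 0 ((n * x) ^ 2) := by
  simp only [szaszK, besselSeries, pow_mul, add_zero, pow_two (Nat.factorial _ : ℝ)]

lemma szaszK_pos (n : ℕ) (x : ℝ) : 0 < szaszK n x := by
  rw [szaszK_eq_exp_mul_besselSeries]
  refine mul_pos (Real.exp_pos _) ?_
  exact (summable_besselSeries 0 _).tsum_pos (fun k => by positivity) 0 (by simp)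

lemma hasDerivAt_besselSeries_sq (m n : ℕ) (x : ℝ) :
    HasDerivAt (fun x : ℝ => besselSeries m ((n * x) ^ 2))
      (besselSeries (m + 1) ((n * x) ^ 2) * (2 * n ^ 2 * x)) x := by
  refine (hasDerivAt_besselSeries m ((n * x) ^ 2)).comp x (h := fun x : ℝ => (n * x) ^ 2) ?_
  refine (((hasDerivAt_id x).const_mul (n : ℝ)).pow 2).congr_deriv ?_
  simp
  ring

lemma hasDerivAt_exp_neg_two_mul (n : ℕ) (x : ℝ) :
    HasDerivAt (fun x : ℝ => Real.exp (-2 * n * x)) (Real.exp (-2 * n * x) * (-2 * n)) x := by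
  simpa using ((hasDerivAt_id x).const_mul (-2 * (n : ℝ))).exp

lemma hasDerivAt_szaszK (n : ℕ) (x : ℝ) :
    HasDerivAt (szaszK n) (Real.exp (-2 * n * x) *
      (2 * n ^ 2 * x * besselSeries 1 ((n * x) ^ 2) - 2 * n * besselSeries 0 ((n * x) ^ 2))) x := by
  rw [funext (szaszK_eq_exp_mul_besselSeries n)]
  refine ((hasDerivAt_exp_neg_two_mul n x).mul
    (hasDerivAt_besselSeries_sq 0 n x)).congr_deriv ?_
  ring

lemma deriv_szaszK (n : ℕ) :
    deriv (szaszK n) = fun x => Real.exp (-2 * n * x) *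
      (2 * n ^ 2 * x * besselSeries 1 ((n * x) ^ 2) - 2 * n * besselSeries 0 ((n * x) ^ 2)) :=
  funext fun x => (hasDerivAt_szaszK n x).deriv

lemma hasDerivAt_deriv_szaszK (n : ℕ) (x : ℝ) :
    HasDerivAt (deriv (szaszK n)) (Real.exp (-2 * n * x) *
      (8 * n ^ 2 * besselSeries 0 ((n * x) ^ 2)
        - (8 * n ^ 3 * x + 2 * n ^ 2) * besselSeries 1 ((n * x) ^ 2))) x := by
  rw [deriv_szaszK]
  refine ((hasDerivAt_exp_neg_two_mul n x).mul
    ((((hasDerivAt_id x).const_mul (2 * (n : ℝ) ^ 2)).mul (hasDerivAt_besselSeries_sq 1 n x)).sub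
      ((hasDerivAt_besselSeries_sq 0 n x).const_mul (2 * (n : ℝ))))).congr_deriv ?_
  have h := besselSeries_recurrence 0 ((n * x) ^ 2)
  simp only [Nat.cast_zero, zero_add, one_mul, id, mul_one, Pi.mul_apply, Pi.sub_apply,
    one_add_one_eq_two] at h ⊢
  linear_combination (4 * (n : ℝ) ^ 2 * Real.exp (-2 * n * x)) * h

/-- The second-order linear differential equation satisfied by `szaszK n`. -/
lemma szaszK_ode (n : ℕ) (x : ℝ) :
    x * deriv (deriv (szaszK n)) x + (4 * n * x + 1) * deriv (szaszK n) x
      + 2 * n * szaszK n x = 0 := by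
  rw [(hasDerivAt_deriv_szaszK n x).deriv, deriv_szaszK, szaszK_eq_exp_mul_besselSeries]
  ring

/-- If the logarithm of `f` is convex on an open set, then there the square of the first derivative
is at most `f` times the second derivative. -/
lemma sq_deriv_le_mul_deriv_deriv_of_convexOn_log {f : ℝ → ℝ} {S : Set ℝ} (hS : IsOpen S)
    (hpos : ∀ x ∈ S, 0 < f x) (hf : ∀ x ∈ S, DifferentiableAt ℝ f x)
    (hconv : ConvexOn ℝ S fun x => Real.log (f x)) {t : ℝ} (ht : t ∈ S)
    (hf' : DifferentiableAt ℝ (deriv f) t) :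
    deriv f t ^ 2 ≤ f t * deriv (deriv f) t := by
  have hlog : ∀ x ∈ S, HasDerivAt (fun x => Real.log (f x)) (deriv f x / f x) x :=
    fun x hx => (hf x hx).hasDerivAt.log (hpos x hx).ne'
  have hmono : MonotoneOn (fun x => deriv f x / f x) S :=
    (hconv.monotoneOn_deriv fun x hx => (hlog x hx).differentiableAt).congr
      fun x hx => (hlog x hx).deriv
  have hderiv : HasDerivAt (fun x => deriv f x / f x) _ t :=
    hf'.hasDerivAt.div (hf t ht).hasDerivAt (hpos t ht).ne'
  have hnonneg := hmono.derivWithin_nonneg (x := t)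
  rw [derivWithin_of_isOpen hS ht, hderiv.deriv,
    le_div_iff₀ (pow_pos (hpos t ht) 2), zero_mul] at hnonneg
  linarith

/-- If `log K_n` is convex on `(0,∞)`, then for every `t > 0`,
`(-√(1+(4nt)²) - 1 - 4nt)/(2t) ≤ K_n'(t)/K_n(t) ≤ (√(1+(4nt)²) - 1 - 4nt)/(2t)`. -/
theorem szaszK_logderiv_bounds (n : ℕ) (hn : 0 < n)
    (hconv : ConvexOn ℝ (Ioi (0 : ℝ)) (fun x => Real.log (szaszK n x))) :
    ∀ t : ℝ, 0 < t →
      (-Real.sqrt (1 + (4 * n * t) ^ 2) - 1 - 4 * n * t) / (2 * t)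
          ≤ deriv (szaszK n) t / szaszK n t ∧
      deriv (szaszK n) t / szaszK n t
          ≤ (Real.sqrt (1 + (4 * n * t) ^ 2) - 1 - 4 * n * t) / (2 * t) := by
  intro t ht
  have hK := szaszK_pos n t
  have hle := sq_deriv_le_mul_deriv_deriv_of_convexOn_log isOpen_Ioi
    (fun x _ => szaszK_pos n x) (fun x _ => (hasDerivAt_szaszK n x).differentiableAt) hconv ht
    (hasDerivAt_deriv_szaszK n t).differentiableAt
  have hode := szaszK_ode n t
  set u := deriv (szaszK n) t / szaszK n t with hu
  have hd : deriv (szaszK n) t = u * szaszK n t := by rw [hu]; field_simp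
  rw [hd] at hle hode
  have hquad : t * u ^ 2 + (4 * n * t + 1) * u + 2 * n ≤ 0 := by
    refine le_of_mul_le_mul_right (a := szaszK n t ^ 2) ?_ (by positivity)
    linear_combination t * hle + szaszK n t * hode
  have habs : |2 * t * u + (4 * n * t + 1)| ≤ Real.sqrt (1 + (4 * n * t) ^ 2) := by
    refine Real.abs_le_sqrt ?_
    linear_combination 4 * t * hquad
  rw [abs_le] at habs
  rw [div_le_iff₀ (by positivity), le_div_iff₀ (by positivity)]
  constructor <;> linarith [habs.1, habs.2]
end

section
/- Assume that $\log K_1$ is convex on $(0,\infty)$. Then for every $x \ge 0$, $I_0(x)^2 \le \frac{2\exp\left(\sqrt{1+4x^2}-1\right)}{\sqrt{1+4x^2}+1}$. -/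
open Real Set

/-- `I₀ x = ∑_{k≥0} (x/2)^{2k}/(k!)²`, the modified Bessel function of the first kind
of order zero. -/
noncomputable def besselI0 (x : ℝ) : ℝ :=
  ∑' k : ℕ, (x / 2) ^ (2 * k) / (Nat.factorial k : ℝ) ^ 2

/-- The entire series `∑_{k≥0} y^k / (k! (k+n)!)`, which for `y = x²/4` is `(x/2)^{-n} Iₙ(x)`. -/
noncomputable def besselClifford (n : ℕ) (y : ℝ) : ℝ :=
  ∑' k : ℕ, y ^ k / ((Nat.factorial k : ℝ) * (Nat.factorial (k + n) : ℝ))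

lemma abs_div_factorial_mul_factorial_le (a : ℝ) (k m : ℕ) :
    |a / ((Nat.factorial k : ℝ) * (Nat.factorial m : ℝ))| ≤ |a| / (Nat.factorial k : ℝ) := by
  have hk : (0 : ℝ) < Nat.factorial k := by positivity
  have hm : (1 : ℝ) ≤ Nat.factorial m := by exact_mod_cast Nat.factorial_pos m
  rw [abs_div, abs_of_pos (by positivity : (0 : ℝ) < (Nat.factorial k : ℝ) * Nat.factorial m)]
  gcongr
  nlinarith

lemma summable_besselClifford (n : ℕ) (y : ℝ) :
    Summable fun k : ℕ => y ^ k / ((Nat.factorial k : ℝ) * (Nat.factorial (k + n) : ℝ)) := by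
  refine Summable.of_norm_bounded (Real.summable_pow_div_factorial |y|) fun k => ?_
  simpa only [Real.norm_eq_abs, abs_pow] using
    abs_div_factorial_mul_factorial_le (y ^ k) k (k + n)

lemma hasDerivAt_besselClifford (n : ℕ) (y : ℝ) :
    HasDerivAt (besselClifford n) (besselClifford (n + 1) y) y := by
  set R : ℝ := |y| + 1
  have hu : Summable fun k : ℕ => (k : ℝ) * R ^ (k - 1) / (Nat.factorial k : ℝ) := by
    rw [← summable_nat_add_iff 1]
    refine (Real.summable_pow_div_factorial R).congr fun k => ?_
    rw [Nat.factorial_succ]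
    push_cast
    field_simp
  have hy : y ∈ Ioo (-R) R := abs_lt.mp (lt_add_one |y|)
  have hbound : ∀ (k : ℕ) (z : ℝ), z ∈ Ioo (-R) R →
      ‖(k : ℝ) * z ^ (k - 1) / ((Nat.factorial k : ℝ) * (Nat.factorial (k + n) : ℝ))‖
        ≤ (k : ℝ) * R ^ (k - 1) / (Nat.factorial k : ℝ) := by
    intro k z hz
    have hzR : |z| ≤ R := (abs_lt.mpr hz).le
    refine (abs_div_factorial_mul_factorial_le _ _ _).trans ?_
    rw [abs_mul, abs_pow, Nat.abs_cast]
    gcongr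
  have hderiv := hasDerivAt_tsum_of_isPreconnected hu isOpen_Ioo isPreconnected_Ioo
    (fun k z _ => (hasDerivAt_pow k z).div_const
      ((Nat.factorial k : ℝ) * (Nat.factorial (k + n) : ℝ)))
    hbound hy (summable_besselClifford n y) hy
  convert! hderiv using 1
  have hsum := Summable.of_norm_bounded hu fun k => hbound k y hy
  rw [hsum.tsum_eq_zero_add]
  simp only [besselClifford, Nat.cast_zero, zero_mul, zero_div, zero_add]
  refine tsum_congr fun k => ?_
  rw [Nat.factorial_succ, show k + 1 + n = k + (n + 1) by ring, Nat.add_sub_cancel]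
  push_cast
  field_simp

lemma besselClifford_zero_eq (y : ℝ) :
    besselClifford 0 y = besselClifford 1 y + y * besselClifford 2 y := by
  have h1 := summable_besselClifford 1 y
  have h2 := (summable_nat_add_iff 1).mpr (summable_besselClifford 0 y)
  have h3 := (summable_nat_add_iff 1).mpr h1
  unfold besselClifford
  rw [(summable_besselClifford 0 y).tsum_eq_zero_add, h1.tsum_eq_zero_add, ← tsum_mul_left,
    add_assoc, ← h3.tsum_add ((summable_besselClifford 2 y).mul_left y)]
  simp only [pow_zero, zero_add, Nat.factorial_zero, Nat.factorial_one, add_zero]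
  congr 1
  refine tsum_congr fun k => ?_
  simp only [Nat.factorial_succ]
  push_cast
  field_simp
  ring

lemma besselClifford_nonneg (n : ℕ) {y : ℝ} (hy : 0 ≤ y) : 0 ≤ besselClifford n y :=
  tsum_nonneg fun k => by positivity

lemma besselI0_eq_besselClifford (x : ℝ) : besselI0 x = besselClifford 0 (x ^ 2 / 4) := by
  refine tsum_congr fun k => ?_
  rw [pow_mul, add_zero, ← sq]
  congr 2
  ring

lemma besselI0_zero : besselI0 0 = 1 := by
  rw [besselI0, tsum_eq_single 0 fun k hk => by simp [hk]]
  simp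

lemma besselI0_nonneg (x : ℝ) : 0 ≤ besselI0 x := by
  rw [besselI0_eq_besselClifford]
  exact besselClifford_nonneg 0 (by positivity)

/-- The modified Bessel function of the first kind of order one. -/
noncomputable def besselI1 (x : ℝ) : ℝ := x / 2 * besselClifford 1 (x ^ 2 / 4)

lemma besselI1_nonneg {x : ℝ} (hx : 0 ≤ x) : 0 ≤ besselI1 x :=
  mul_nonneg (by positivity) (besselClifford_nonneg 1 (by positivity))

lemma hasDerivAt_besselClifford_sq_div_four (n : ℕ) (x : ℝ) :
    HasDerivAt (fun t => besselClifford n (t ^ 2 / 4))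
      (x / 2 * besselClifford (n + 1) (x ^ 2 / 4)) x := by
  have hsq : HasDerivAt (fun t : ℝ => t ^ 2 / 4) (x / 2) x := by
    convert! (hasDerivAt_pow 2 x).div_const 4 using 1
    push_cast
    ring
  rw [mul_comm]
  exact (hasDerivAt_besselClifford n (x ^ 2 / 4)).comp x hsq

lemma hasDerivAt_besselI0 (x : ℝ) : HasDerivAt besselI0 (besselI1 x) x := by
  rw [funext besselI0_eq_besselClifford]
  exact hasDerivAt_besselClifford_sq_div_four 0 x

lemma hasDerivAt_besselI1 (x : ℝ) :
    HasDerivAt besselI1 (besselI0 x - besselClifford 1 (x ^ 2 / 4) / 2) x := by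
  convert! ((hasDerivAt_id x).div_const 2).mul (hasDerivAt_besselClifford_sq_div_four 1 x) using 1
  rw [besselI0_eq_besselClifford, besselClifford_zero_eq]
  simp only [id]
  ring

/-- This inequality expresses the convexity of `log I₀`. -/
lemma besselI0_mul_besselI1_le {x : ℝ} (hx : 0 ≤ x) :
    besselI0 x * besselI1 x ≤ x * besselI0 x ^ 2 - x * besselI1 x ^ 2 := by
  have hderiv : ∀ t : ℝ, HasDerivAt
      (fun t => t * besselI0 t ^ 2 - t * besselI1 t ^ 2 - besselI0 t * besselI1 t)
      (besselI0 t * besselClifford 1 (t ^ 2 / 4) / 2) t := by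
    intro t
    have h0 := hasDerivAt_besselI0 t
    have h1 := hasDerivAt_besselI1 t
    convert! (((hasDerivAt_id t).mul (h0.pow 2)).sub ((hasDerivAt_id t).mul (h1.pow 2))).sub
      (h0.mul h1) using 1
    simp only [id, besselI1, Pi.pow_apply]
    push_cast
    ring
  have hmono := monotoneOn_of_hasDerivWithinAt_nonneg (convex_Ici (0 : ℝ))
    (fun t _ => (hderiv t).continuousAt.continuousWithinAt)
    (fun t _ => (hderiv t).hasDerivWithinAt)
    (fun t _ => div_nonneg (mul_nonneg (besselI0_nonneg t)
      (besselClifford_nonneg 1 (by positivity))) zero_le_two)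
  have h := hmono self_mem_Ici hx hx
  simp only [besselI1, zero_mul, zero_div, mul_zero, sub_zero] at h
  simp only [besselI1]
  linarith

lemma besselI1_mul_le {x : ℝ} (hx : 0 < x) :
    besselI1 x * (√(1 + 4 * x ^ 2) + 1) ≤ 2 * x * besselI0 x := by
  have hA := besselI0_nonneg x
  have hB := besselI1_nonneg hx.le
  have hAB := besselI0_mul_besselI1_le hx.le
  have hs := Real.sq_sqrt (by positivity : (0 : ℝ) ≤ 1 + 4 * x ^ 2)
  have hs0 := Real.sqrt_nonneg (1 + 4 * x ^ 2)
  set s := √(1 + 4 * x ^ 2)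
  have hle : 2 * x * besselI1 x + besselI0 x ≤ besselI0 x * s := by
    refine le_of_sq_le_sq ?_ (by positivity)
    rw [mul_pow, hs]
    nlinarith [mul_le_mul_of_nonneg_left hAB hx.le]
  refine le_of_mul_le_mul_left ?_ (by positivity : (0 : ℝ) < 2 * x)
  have := mul_le_mul_of_nonneg_right hle (by positivity : (0 : ℝ) ≤ s + 1)
  linear_combination this + besselI0 x * hs

lemma antitoneOn_besselI0_sq_mul :
    AntitoneOn (fun x => besselI0 x ^ 2 * ((√(1 + 4 * x ^ 2) + 1) * Real.exp (-√(1 + 4 * x ^ 2))))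
      (Ici 0) := by
  have hderiv : ∀ x : ℝ, HasDerivAt
      (fun x => besselI0 x ^ 2 * ((√(1 + 4 * x ^ 2) + 1) * Real.exp (-√(1 + 4 * x ^ 2))))
      (2 * Real.exp (-√(1 + 4 * x ^ 2)) * besselI0 x *
        (besselI1 x * (√(1 + 4 * x ^ 2) + 1) - 2 * x * besselI0 x)) x := by
    intro x
    have hpos : (0 : ℝ) < 1 + 4 * x ^ 2 := by positivity
    have hs := (((hasDerivAt_pow 2 x).const_mul 4).const_add 1).sqrt hpos.ne'
    convert! ((hasDerivAt_besselI0 x).pow 2).mul ((hs.add_const 1).mul hs.neg.exp) using 1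
    have hs0 : √(1 + 4 * x ^ 2) ≠ 0 := (Real.sqrt_pos.mpr hpos).ne'
    simp only [Pi.pow_apply, Pi.mul_apply, Pi.neg_apply]
    push_cast
    field_simp
    ring
  refine antitoneOn_of_hasDerivWithinAt_nonpos (convex_Ici (0 : ℝ))
    (fun x _ => (hderiv x).continuousAt.continuousWithinAt)
    (fun x _ => (hderiv x).hasDerivWithinAt) fun x hx => ?_
  rw [interior_Ici] at hx
  exact mul_nonpos_of_nonneg_of_nonpos (mul_nonneg (by positivity) (besselI0_nonneg x))
    (sub_nonpos.mpr (besselI1_mul_le hx))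

/-- If `log K_1` is convex on `(0,∞)`, then for every `x ≥ 0`,
`I₀(x)² ≤ 2 exp(√(1+4x²) - 1) / (√(1+4x²) + 1)`. -/
theorem besselI0_sq_upper_bound
    (hconv : ConvexOn ℝ (Ioi (0 : ℝ)) (fun x => Real.log (szaszK 1 x))) :
    ∀ x : ℝ, 0 ≤ x →
      (besselI0 x) ^ 2 ≤
        2 * Real.exp (Real.sqrt (1 + 4 * x ^ 2) - 1) / (Real.sqrt (1 + 4 * x ^ 2) + 1) := by
  intro x hx
  have h := antitoneOn_besselI0_sq_mul self_mem_Ici hx hx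
  simp only [besselI0_zero, one_pow, one_mul, ne_eq, OfNat.ofNat_ne_zero, not_false_eq_true,
    zero_pow, mul_zero, add_zero, Real.sqrt_one, one_add_one_eq_two] at h
  rw [le_div_iff₀ (by positivity)]
  have hexp := mul_le_mul_of_nonneg_right h (Real.exp_pos √(1 + 4 * x ^ 2)).le
  calc besselI0 x ^ 2 * (√(1 + 4 * x ^ 2) + 1)
      = besselI0 x ^ 2 * ((√(1 + 4 * x ^ 2) + 1) * Real.exp (-√(1 + 4 * x ^ 2)))
          * Real.exp √(1 + 4 * x ^ 2) := by
        rw [mul_assoc, mul_assoc, ← Real.exp_add, neg_add_cancel, Real.exp_zero, mul_one]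
    _ ≤ 2 * Real.exp (-1) * Real.exp √(1 + 4 * x ^ 2) := hexp
    _ = 2 * Real.exp (√(1 + 4 * x ^ 2) - 1) := by
        rw [mul_assoc, ← Real.exp_add, neg_add_eq_sub]
end

section
/- Let $n$ be a positive integer and assume that $\log F_n$ is convex on $[0,1]$. Then for every $x \in (0,1/2)$, writing $X = x(1-x)$ and $X' = 1-2x$, one has $\frac{F_n'(x)}{F_n(x)} \le \frac{\sqrt{(1-4X)^2+(4nX)^2}-(1-4X)-4nX}{2XX'}$. -/
open Real Set

/-- `F n x = ∑_{k=0}^n C(n,k)² x^{2k} (1-x)^{2(n-k)}`, the sum of the squares of the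
Bernstein basis polynomials. -/
noncomputable def bernsteinF (n : ℕ) (x : ℝ) : ℝ :=
  ∑ k ∈ Finset.range (n + 1),
    (Nat.choose n k : ℝ) ^ 2 * x ^ (2 * k) * (1 - x) ^ (2 * (n - k))

/-- The derivative of `x ↦ x ^ a * (1 - x) ^ b`, in logarithmic form. -/
lemma hasDerivAt_pow_mul_one_sub_pow (a b : ℕ) {x : ℝ} (hx : x ≠ 0) (hy : 1 - x ≠ 0) :
    HasDerivAt (fun z : ℝ => z ^ a * (1 - z) ^ b)
      (x ^ a * (1 - x) ^ b * (a / x - b / (1 - x))) x := by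
  have h := (hasDerivAt_pow a x).mul (((hasDerivAt_id x).const_sub 1).pow b)
  refine h.congr_deriv ?_
  rcases a with _ | a <;> rcases b with _ | b <;> simp <;> field_simp <;> ring

/-- The second derivative of `x ↦ x ^ a * (1 - x) ^ b`, in logarithmic form. -/
lemma hasDerivAt_pow_mul_one_sub_pow_logDeriv (a b : ℕ) {x : ℝ} (hx : x ≠ 0) (hy : 1 - x ≠ 0) :
    HasDerivAt (fun z : ℝ => z ^ a * (1 - z) ^ b * (a / z - b / (1 - z)))
      (x ^ a * (1 - x) ^ b *
        ((a / x - b / (1 - x)) ^ 2 - a / x ^ 2 - b / (1 - x) ^ 2)) x := by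
  have h₁ := (hasDerivAt_const x (a : ℝ)).div (hasDerivAt_id x) hx
  have h₂ := (hasDerivAt_const x (b : ℝ)).div ((hasDerivAt_id x).const_sub 1) hy
  refine ((hasDerivAt_pow_mul_one_sub_pow a b hx hy).mul (h₁.sub h₂)).congr_deriv ?_
  simp only [Pi.sub_apply, Pi.div_apply, id]
  ring

/-- The first derivative of `bernsteinF n` away from `0` and `1`. -/
noncomputable def bernsteinFDeriv (n : ℕ) (x : ℝ) : ℝ :=
  ∑ k ∈ Finset.range (n + 1), (Nat.choose n k : ℝ) ^ 2 *
    (x ^ (2 * k) * (1 - x) ^ (2 * (n - k)) *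
      ((2 * k : ℕ) / x - (2 * (n - k) : ℕ) / (1 - x)))

/-- The second derivative of `bernsteinF n` away from `0` and `1`. -/
noncomputable def bernsteinFDeriv2 (n : ℕ) (x : ℝ) : ℝ :=
  ∑ k ∈ Finset.range (n + 1), (Nat.choose n k : ℝ) ^ 2 *
    (x ^ (2 * k) * (1 - x) ^ (2 * (n - k)) *
      (((2 * k : ℕ) / x - (2 * (n - k) : ℕ) / (1 - x)) ^ 2
        - (2 * k : ℕ) / x ^ 2 - (2 * (n - k) : ℕ) / (1 - x) ^ 2))

lemma hasDerivAt_bernsteinF (n : ℕ) {x : ℝ} (hx : x ≠ 0) (hy : 1 - x ≠ 0) :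
    HasDerivAt (bernsteinF n) (bernsteinFDeriv n x) x := by
  have h := HasDerivAt.fun_sum (u := Finset.range (n + 1)) fun k _ =>
    (hasDerivAt_pow_mul_one_sub_pow (2 * k) (2 * (n - k)) hx hy).const_mul
      ((Nat.choose n k : ℝ) ^ 2)
  refine h.congr_of_eventuallyEq (.of_forall fun z => ?_)
  simp only [bernsteinF, mul_assoc]

lemma hasDerivAt_bernsteinFDeriv (n : ℕ) {x : ℝ} (hx : x ≠ 0) (hy : 1 - x ≠ 0) :
    HasDerivAt (bernsteinFDeriv n) (bernsteinFDeriv2 n x) x :=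
  HasDerivAt.fun_sum (u := Finset.range (n + 1)) fun k _ =>
    (hasDerivAt_pow_mul_one_sub_pow_logDeriv (2 * k) (2 * (n - k)) hx hy).const_mul
      ((Nat.choose n k : ℝ) ^ 2)

lemma bernsteinF_pos (n : ℕ) {x : ℝ} (hx : x < 1) : 0 < bernsteinF n x := by
  have hy : 0 < 1 - x := sub_pos.2 hx
  refine Finset.sum_pos' (fun k _ => ?_) ⟨0, by simp, by simp; positivity⟩
  have : 0 ≤ x ^ (2 * k) := (even_two_mul k).pow_nonneg x
  positivity

/-- The differential equation satisfied by `bernsteinF n`. -/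
lemma bernsteinF_ode (n : ℕ) {x : ℝ} (hx : x ≠ 0) (hy : 1 - x ≠ 0) :
    x * (1 - x) * (1 - 2 * x) * bernsteinFDeriv2 n x
      + (4 * (n - 1) * (x * (1 - x)) + 1) * bernsteinFDeriv n x
      + 2 * n * (1 - 2 * x) * bernsteinF n x = 0 := by
  let G : ℕ → ℝ := fun k =>
    4 * k ^ 2 * (Nat.choose n k : ℝ) ^ 2 *
      (x ^ (2 * k) * (1 - x) ^ (2 * (n - k)) * ((1 - x) / x))
  have telescope : ∑ k ∈ Finset.range (n + 1), (G k - G (k + 1)) = 0 := by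
    rw [Finset.sum_range_sub']
    simp [G]
  rw [← telescope, bernsteinFDeriv, bernsteinFDeriv2, bernsteinF, Finset.mul_sum,
    Finset.mul_sum, Finset.mul_sum, ← Finset.sum_add_distrib, ← Finset.sum_add_distrib]
  refine Finset.sum_congr rfl fun k hk => ?_
  obtain ⟨m, rfl⟩ := Nat.exists_eq_add_of_le (Nat.lt_succ_iff.1 (Finset.mem_range.1 hk))
  have hG : G (k + 1) = 4 * m ^ 2 * (Nat.choose (k + m) k : ℝ) ^ 2 *
      (x ^ (2 * k) * (1 - x) ^ (2 * m) * (x / (1 - x))) := by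
    have hc : ((Nat.choose (k + m) (k + 1) : ℝ)) * (k + 1) = Nat.choose (k + m) k * m := by
      have := Nat.choose_succ_right_eq (k + m) k
      rw [Nat.add_sub_cancel_left] at this
      exact_mod_cast this
    have hc2 : 4 * ((k + 1 : ℕ) : ℝ) ^ 2 * (Nat.choose (k + m) (k + 1) : ℝ) ^ 2
        = 4 * m ^ 2 * (Nat.choose (k + m) k : ℝ) ^ 2 := by
      push_cast
      linear_combination 4 * ((Nat.choose (k + m) (k + 1) : ℝ) * (k + 1)
        + Nat.choose (k + m) k * m) * hc
    simp only [G]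
    rw [hc2]
    rcases m with _ | m
    · simp
    · rw [show k + (m + 1) - (k + 1) = m by omega]
      field_simp
      ring
  rw [hG]
  simp only [G, Nat.add_sub_cancel_left]
  push_cast
  field_simp
  ring

/-- Log-convexity of `bernsteinF n`, expressed through its first two derivatives. -/
lemma bernsteinFDeriv_sq_le (n : ℕ)
    (hconv : ConvexOn ℝ (Icc (0 : ℝ) 1) (fun x => Real.log (bernsteinF n x)))
    {x : ℝ} (hx : x ∈ Ioo (0 : ℝ) 1) :
    bernsteinFDeriv n x ^ 2 ≤ bernsteinFDeriv2 n x * bernsteinF n x := by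
  have hlog : ∀ z ∈ Ioo (0 : ℝ) 1, HasDerivAt (fun x => Real.log (bernsteinF n x))
      (bernsteinFDeriv n z / bernsteinF n z) z := fun z hz =>
    (hasDerivAt_bernsteinF n hz.1.ne' (sub_pos.2 hz.2).ne').log (bernsteinF_pos n hz.2).ne'
  have hmono : MonotoneOn (fun z => bernsteinFDeriv n z / bernsteinF n z) (Ioo 0 1) :=
    ((hconv.subset Ioo_subset_Icc_self (convex_Ioo 0 1)).monotoneOn_deriv
      fun z hz => (hlog z hz).differentiableAt).congr fun z hz => (hlog z hz).deriv
  have hF := bernsteinF_pos n hx.2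
  have hd := (hasDerivAt_bernsteinFDeriv n hx.1.ne' (sub_pos.2 hx.2).ne').div
    (hasDerivAt_bernsteinF n hx.1.ne' (sub_pos.2 hx.2).ne') hF.ne'
  have h0 :=
    (hmono.derivWithin_nonneg (x := x)).trans_eq
      (hd.hasDerivWithinAt.derivWithin (isOpen_Ioo.uniqueDiffWithinAt hx))
  rw [le_div_iff₀ (by positivity)] at h0
  linarith

/-- If `log F_n` is convex on `[0,1]`, then for every `x ∈ (0,1/2)`,
writing `X = x(1-x)` and `X' = 1-2x`,
`F_n'(x)/F_n(x) ≤ (√((1-4X)² + (4nX)²) - (1-4X) - 4nX) / (2XX')`. -/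
theorem bernsteinF_logderiv_upper_bound (n : ℕ) (hn : 0 < n)
    (hconv : ConvexOn ℝ (Icc (0 : ℝ) 1) (fun x => Real.log (bernsteinF n x))) :
    ∀ x ∈ Ioo (0 : ℝ) (1 / 2),
      deriv (bernsteinF n) x / bernsteinF n x ≤
        (Real.sqrt ((1 - 4 * (x * (1 - x))) ^ 2 + (4 * n * (x * (1 - x))) ^ 2)
            - (1 - 4 * (x * (1 - x))) - 4 * n * (x * (1 - x)))
          / (2 * (x * (1 - x)) * (1 - 2 * x)) := by
  intro x hx
  have hx1 : x < 1 := by linarith [hx.2]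
  have hy : 0 < 1 - x := sub_pos.2 hx1
  have hX' : 0 < 1 - 2 * x := by linarith [hx.2]
  have hX : 0 < x * (1 - x) := mul_pos hx.1 hy
  have hF := bernsteinF_pos n hx1
  have ode := bernsteinF_ode n hx.1.ne' hy.ne'
  have hsq := bernsteinFDeriv_sq_le n hconv ⟨hx.1, hx1⟩
  rw [(hasDerivAt_bernsteinF n hx.1.ne' hy.ne').deriv]
  set u := bernsteinFDeriv n x / bernsteinF n x with hu
  have hu1 : bernsteinFDeriv n x = u * bernsteinF n x := by rw [hu]; field_simp
  rw [hu1] at ode hsq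
  have hu2 : u ^ 2 * bernsteinF n x ≤ bernsteinFDeriv2 n x :=
    le_of_mul_le_mul_right (by linarith) hF
  have quad : x * (1 - x) * (1 - 2 * x) * u ^ 2 + (4 * (n - 1) * (x * (1 - x)) + 1) * u
      + 2 * n * (1 - 2 * x) ≤ 0 := by
    refine le_of_mul_le_mul_right ?_ hF
    linarith [mul_le_mul_of_nonneg_left hu2 (mul_pos hX hX').le]
  rw [le_div_iff₀ (by positivity)]
  have hroot : u * (2 * (x * (1 - x)) * (1 - 2 * x)) + (1 - 4 * (x * (1 - x)))
      + 4 * n * (x * (1 - x)) ≤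
      Real.sqrt ((1 - 4 * (x * (1 - x))) ^ 2 + (4 * n * (x * (1 - x))) ^ 2) := by
    refine Real.le_sqrt_of_sq_le ?_
    linarith [mul_le_mul_of_nonneg_left quad (mul_pos hX hX').le]
  linarith
end

section
/- Let $n$ be a positive integer and assume that $\log F_n$ is convex on $[0,1]$. Then for every $t > 1$, $\frac{P_n'(t)}{P_n(t)} \le \frac{\sqrt{4n^2(t^2-1)+(t-\sqrt{t^2-1})^2}-(t-\sqrt{t^2-1})}{2(t^2-1)}$. -/
open Real Set Polynomial

/-- The `n`-th Legendre polynomial, via the Rodrigues formula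
`P_n = (1/(2ⁿ n!)) dⁿ/dtⁿ [(t²-1)ⁿ]`. -/
noncomputable def legendreP (n : ℕ) : Polynomial ℝ :=
  (1 / (2 ^ n * (Nat.factorial n : ℝ))) •
    (fun q : Polynomial ℝ => Polynomial.derivative q)^[n] ((X ^ 2 - 1) ^ n)

lemma eval_legendreP (n : ℕ) (t : ℝ) :
    (legendreP n).eval t = (1 / 2 ^ n) * ∑ k ∈ Finset.range (n + 1),
      (n.choose k : ℝ) ^ 2 * (t - 1) ^ k * (t + 1) ^ (n - k) := by
  have hfac : (X ^ 2 - 1 : ℝ[X]) ^ n = (X - C 1) ^ n * (X + C 1) ^ n := by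
    rw [← mul_pow, C_1]
    ring
  have hiter : derivative^[n] ((X ^ 2 - 1 : ℝ[X]) ^ n) = ∑ k ∈ Finset.range (n + 1),
      n.choose k • (derivative^[n - k] ((X - C 1) ^ n) * derivative^[k] ((X + C 1) ^ n)) := by
    rw [hfac, iterate_derivative_mul]
  unfold legendreP
  rw [eval_smul]
  change _ • eval t (derivative^[n] ((X ^ 2 - 1) ^ n)) = _
  rw [hiter, eval_finsetSum, smul_eq_mul, Finset.mul_sum, Finset.mul_sum]
  refine Finset.sum_congr rfl fun k hk => ?_
  have hkn : k ≤ n := Nat.lt_succ_iff.1 (Finset.mem_range.1 hk)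
  have hcoef : (n.descFactorial (n - k) : ℝ) * n.descFactorial k = n.factorial * n.choose k := by
    have h := Nat.factorial_mul_descFactorial (Nat.sub_le n k)
    rw [Nat.sub_sub_self hkn] at h
    rw [Nat.descFactorial_eq_factorial_mul_choose n k, ← h]
    push_cast
    ring
  have hfact : (n.factorial : ℝ) ≠ 0 := by positivity
  rw [iterate_derivative_X_sub_pow, iterate_derivative_X_add_pow, Nat.sub_sub_self hkn]
  simp only [nsmul_eq_mul, eval_mul, eval_natCast, eval_pow, eval_sub, eval_add, eval_X, eval_C]
  field_simp
  linear_combination (n.choose k * (t - 1) ^ k * (t + 1) ^ (n - k) : ℝ) * hcoef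

lemma eval_legendreP_pos (n : ℕ) {t : ℝ} (ht : 1 < t) : 0 < (legendreP n).eval t := by
  rw [eval_legendreP]
  refine mul_pos (by positivity) (Finset.sum_pos (fun k hk => ?_) (by simp))
  have : 0 < n.choose k := Nat.choose_pos (Nat.lt_succ_iff.1 (Finset.mem_range.1 hk))
  have : 0 < t - 1 := by linarith
  positivity

/-- The Legendre differential equation `(t² - 1) P_n'' + 2 t P_n' = n (n + 1) P_n`. -/
lemma legendreP_ode (n : ℕ) :
    (X ^ 2 - 1) * derivative (derivative (legendreP n)) + 2 * X * derivative (legendreP n)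
      = (n * (n + 1) : ℝ[X]) * legendreP n := by
  set q : ℝ[X] := (X ^ 2 - 1) ^ n with hq
  have hbase : (X ^ 2 - 1) * derivative q = 2 * (n : ℝ[X]) * X * q := by
    rcases n with _ | m
    · simp [hq]
    · simp [hq, derivative_pow, show (C 2 : ℝ[X]) = 2 from rfl]
      ring
  have hiter : ∀ k : ℕ, (X ^ 2 - 1) * derivative (derivative (derivative^[k] q))
      + 2 * ((k : ℝ[X]) + 1) * X * derivative (derivative^[k] q)
      + (k : ℝ[X]) * ((k : ℝ[X]) + 1) * derivative^[k] q
      = 2 * (n : ℝ[X]) * (X * derivative (derivative^[k] q)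
        + ((k : ℝ[X]) + 1) * derivative^[k] q) := by
    intro k
    induction k with
    | zero =>
      have h := congrArg derivative hbase
      simp [derivative_mul] at h ⊢
      linear_combination h
    | succ k ih =>
      have h := congrArg derivative ih
      rw [Function.iterate_succ_apply']
      simp [derivative_mul] at h ⊢
      linear_combination h
  have hP : legendreP n = C (1 / (2 ^ n * (n.factorial : ℝ))) * derivative^[n] q := by
    rw [← smul_eq_C_mul]
    rfl
  rw [hP]
  simp only [derivative_C_mul]
  linear_combination C (1 / (2 ^ n * (n.factorial : ℝ))) * hiter n

lemma bernsteinF_eq (n : ℕ) {x : ℝ} (hx : 1 - 2 * x ≠ 0) :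
    bernsteinF n x =
      (1 - 2 * x) ^ n * (legendreP n).eval (((1 - 2 * x) + (1 - 2 * x)⁻¹) / 2) := by
  rw [eval_legendreP, bernsteinF, ← mul_assoc, Finset.mul_sum]
  refine Finset.sum_congr rfl fun k hk => ?_
  have hkn : k ≤ n := Nat.lt_succ_iff.1 (Finset.mem_range.1 hk)
  have hsub : ((1 - 2 * x) + (1 - 2 * x)⁻¹) / 2 - 1 = 2 / (1 - 2 * x) * x ^ 2 := by
    field_simp
    ring
  have hadd : ((1 - 2 * x) + (1 - 2 * x)⁻¹) / 2 + 1 = 2 / (1 - 2 * x) * (1 - x) ^ 2 := by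
    field_simp
    ring
  have hpow : (2 / (1 - 2 * x)) ^ k * (2 / (1 - 2 * x)) ^ (n - k) = 2 ^ n / (1 - 2 * x) ^ n := by
    rw [← pow_add, Nat.add_sub_cancel' hkn, div_pow]
  rw [hsub, hadd, mul_pow (2 / (1 - 2 * x)), mul_pow (2 / (1 - 2 * x)), pow_mul, pow_mul]
  have hone : (1 - 2 * x) ^ n * (1 / 2 ^ n) *
      ((2 / (1 - 2 * x)) ^ k * (2 / (1 - 2 * x)) ^ (n - k)) = 1 := by
    rw [hpow]
    have := pow_ne_zero n hx
    field_simp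
  linear_combination (-(n.choose k : ℝ) ^ 2 * (x ^ 2) ^ k * ((1 - x) ^ 2) ^ (n - k)) * hone

lemma one_lt_half_add_inv {w : ℝ} (hw0 : 0 < w) (hw1 : w < 1) : 1 < (w + w⁻¹) / 2 := by
  have : 0 < (1 - w) ^ 2 / w := div_pos (pow_pos (by linarith) 2) hw0
  have h : (w + w⁻¹) / 2 - 1 = (1 - w) ^ 2 / w / 2 := by
    field_simp
    ring
  linarith

lemma hasDerivAt_half_add_inv {x : ℝ} (hx : 1 - 2 * x ≠ 0) :
    HasDerivAt (fun y : ℝ => ((1 - 2 * y) + (1 - 2 * y)⁻¹) / 2)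
      (((1 - 2 * x) ^ 2)⁻¹ - 1) x := by
  have h : HasDerivAt (fun y : ℝ => 1 - 2 * y) (-2) x := by
    simpa using ((hasDerivAt_id x).const_mul 2).const_sub 1
  refine ((h.add (h.inv hx)).div_const 2).congr_deriv ?_
  field_simp
  ring

/-- With `w = e^{-θ}` and `t = cosh θ`, convexity of `log F_n` gives
`0 ≤ n² - w u - (sinh θ)² u²`, where `u = P_n'(t) / P_n(t)`. -/
lemma riccati_nonneg_of_convexOn (n : ℕ)
    (hconv : ConvexOn ℝ (Icc (0 : ℝ) 1) (fun x => Real.log (bernsteinF n x)))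
    {w : ℝ} (hw0 : 0 < w) (hw1 : w < 1) :
    0 ≤ (n : ℝ) ^ 2
      - w * ((derivative (legendreP n)).eval ((w + w⁻¹) / 2) /
          (legendreP n).eval ((w + w⁻¹) / 2))
      - ((w⁻¹ - w) / 2) ^ 2 * ((derivative (legendreP n)).eval ((w + w⁻¹) / 2) /
          (legendreP n).eval ((w + w⁻¹) / 2)) ^ 2 := by
  set P := legendreP n with hP
  set T : ℝ → ℝ := fun y => ((1 - 2 * y) + (1 - 2 * y)⁻¹) / 2 with hT
  have hpos : ∀ y ∈ Ioo (0 : ℝ) (1 / 2), 0 < 1 - 2 * y ∧ 0 < P.eval (T y) := by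
    rintro y ⟨hy0, hy1⟩
    have hy : 0 < 1 - 2 * y := by linarith
    exact ⟨hy, eval_legendreP_pos n (one_lt_half_add_inv hy (by linarith))⟩
  set h : ℝ → ℝ := fun y => n * Real.log (1 - 2 * y) + Real.log (P.eval (T y))
  set h₁ : ℝ → ℝ := fun y => n * (-2 / (1 - 2 * y)) +
    (derivative P).eval (T y) * (((1 - 2 * y) ^ 2)⁻¹ - 1) / P.eval (T y)
  have hlin : ∀ y : ℝ, HasDerivAt (fun y : ℝ => 1 - 2 * y) (-2) y := fun y => by
    simpa using ((hasDerivAt_id y).const_mul 2).const_sub 1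
  have hcomp : ∀ (p : ℝ[X]), ∀ y ∈ Ioo (0 : ℝ) (1 / 2),
      HasDerivAt (fun y => p.eval (T y))
        ((derivative p).eval (T y) * (((1 - 2 * y) ^ 2)⁻¹ - 1)) y := fun p y hy =>
    (p.hasDerivAt (T y)).comp y (hasDerivAt_half_add_inv (hpos y hy).1.ne')
  have hderiv : ∀ y ∈ Ioo (0 : ℝ) (1 / 2), HasDerivAt h (h₁ y) y := fun y hy =>
    (((hlin y).log (hpos y hy).1.ne').const_mul (n : ℝ)).add
      ((hcomp P y hy).log (hpos y hy).2.ne')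
  have hconv' : ConvexOn ℝ (Ioo (0 : ℝ) (1 / 2)) h := by
    refine (hconv.subset (fun y hy => ⟨hy.1.le, by linarith [hy.2]⟩)
      (convex_Ioo _ _)).congr fun y hy => ?_
    have hy' := hpos y hy
    change Real.log (bernsteinF n y) = _
    rw [bernsteinF_eq n hy'.1.ne', Real.log_mul (pow_pos hy'.1 n).ne' hy'.2.ne', Real.log_pow]
  have hmono : MonotoneOn h₁ (Ioo (0 : ℝ) (1 / 2)) :=
    (hconv'.monotoneOn_deriv fun y hy => (hderiv y hy).differentiableAt).congr
      fun y hy => (hderiv y hy).deriv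
  set x : ℝ := (1 - w) / 2 with hx_def
  have hx : x ∈ Ioo (0 : ℝ) (1 / 2) := ⟨by linarith, by linarith⟩
  have hxw : 1 - 2 * x = w := by rw [hx_def]; ring
  have hTx : T x = (w + w⁻¹) / 2 := by simp only [hT, hxw]
  have hpx := (hpos x hx).2
  have hderiv₁ := (((hasDerivAt_const x (-2 : ℝ)).div (hlin x) (hpos x hx).1.ne').const_mul
    (n : ℝ)).add ((((hcomp (derivative P) x hx).mul
      ((((hlin x).pow 2).inv (pow_pos (hpos x hx).1 2).ne').sub_const 1))).div
        (hcomp P x hx) hpx.ne')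
  have hnonneg := hmono.derivWithin_nonneg (x := x)
  rw [HasDerivWithinAt.derivWithin (f := h₁) hderiv₁.hasDerivWithinAt
    (isOpen_Ioo.uniqueDiffWithinAt hx)] at hnonneg
  have hode := congrArg (Polynomial.eval ((w + w⁻¹) / 2)) (legendreP_ode n)
  simp only [eval_mul, eval_add, eval_sub, eval_pow, eval_X, eval_one, eval_natCast,
    eval_ofNat, ← hP] at hode
  simp only [Pi.pow_apply, Pi.mul_apply, Pi.inv_apply, hxw, hTx] at hnonneg hpx
  generalize (derivative (derivative P)).eval ((w + w⁻¹) / 2) = c at *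
  generalize (derivative P).eval ((w + w⁻¹) / 2) = b at *
  generalize P.eval ((w + w⁻¹) / 2) = a at *
  have hode' : ((w⁻¹ - w) / 2) ^ 2 * (c / a) = n * (n + 1) - (w + w⁻¹) * (b / a) := by
    field_simp
    field_simp at hode
    linear_combination hode
  refine (mul_nonneg (by positivity : 0 ≤ w ^ 2 / 4) hnonneg).trans_eq ?_
  trans -n + (b / a) / w + ((w⁻¹ - w) / 2) ^ 2 * (c / a - (b / a) ^ 2)
  · field_simp
    ring
  · linear_combination hode'

/-- If `log F_n` is convex on `[0,1]`, then for every `t > 1`,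
`P_n'(t)/P_n(t) ≤ (√(4n²(t²-1) + (t-√(t²-1))²) - (t-√(t²-1))) / (2(t²-1))`. -/
theorem legendre_logderiv_upper_bound (n : ℕ) (hn : 0 < n)
    (hconv : ConvexOn ℝ (Icc (0 : ℝ) 1) (fun x => Real.log (bernsteinF n x))) :
    ∀ t : ℝ, 1 < t →
      (Polynomial.derivative (legendreP n)).eval t / (legendreP n).eval t ≤
        (Real.sqrt (4 * n ^ 2 * (t ^ 2 - 1) + (t - Real.sqrt (t ^ 2 - 1)) ^ 2)
            - (t - Real.sqrt (t ^ 2 - 1)))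
          / (2 * (t ^ 2 - 1)) := by
  intro t ht
  have hs2 : √(t ^ 2 - 1) ^ 2 = t ^ 2 - 1 := Real.sq_sqrt (by nlinarith)
  have hs0 : 0 < √(t ^ 2 - 1) := Real.sqrt_pos.2 (by nlinarith)
  set s := √(t ^ 2 - 1)
  have hw0 : 0 < t - s := by nlinarith
  have hw1 : t - s < 1 := by nlinarith
  have htw : ((t - s) + (t - s)⁻¹) / 2 = t := by
    field_simp
    linear_combination hs2
  have hrat := riccati_nonneg_of_convexOn n hconv hw0 hw1
  rw [htw] at hrat
  set u := (derivative (legendreP n)).eval t / (legendreP n).eval t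
  rw [show ((t - s)⁻¹ - (t - s)) / 2 = s by field_simp; linear_combination hs2] at hrat
  rw [← hs2, le_div_iff₀ (by positivity), le_sub_iff_add_le]
  apply Real.le_sqrt_of_sq_le
  nlinarith [mul_nonneg (sq_nonneg s) hrat]
end

section
/- Let $n \ge 2$ be an integer. For every $t \ge 1$, $\left(t+\sqrt{t^2-1}\right)^{\frac{n(2n^2-1)}{2n^2-n-2}}\left(t+\frac{2n^2-1}{n+1}\sqrt{t^2-1}\right)^{-\frac{n(n+1)}{2n^2-n-2}} \le \left(t+\sqrt{t^2-1}\right)^{\frac{n(2n-1)}{2(n-1)}}\left(t+(2n-1)\sqrt{t^2-1}\right)^{-\frac{n}{2(n-1)}}$; that is, the upper bound for the Legendre polynomial $P_n(t)$ in inequality (2.16) of the paper is stronger than the one in inequality (2.17). -/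
open Real

/-- Factoring `u` out of the second base: only `u ^ m` and a power of `1 + a * (s / u)` remain. -/
lemma rpow_mul_add_rpow_eq {u s m a : ℝ} (hu : 0 < u) (hs : 0 ≤ s) (ha : 0 < a) :
    u ^ (m * (1 + a) / a) * (u + a * s) ^ (-(m / a)) = u ^ m * (1 + a * (s / u)) ^ (-(m / a)) := by
  have hfac : u + a * s = u * (1 + a * (s / u)) := by field_simp
  have hexp : m * (1 + a) / a + -(m / a) = m := by field_simp; ring
  rw [hfac, mul_rpow hu.le (by positivity), ← mul_assoc, ← rpow_add hu, hexp]

/-- The function `a ↦ (1 + a * y) ^ (-(m / a))` is monotone on the positive reals. -/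
lemma one_add_mul_rpow_neg_div_le {y m a b : ℝ} (hy : 0 ≤ y) (hm : 0 ≤ m) (ha : 0 < a)
    (hab : a ≤ b) : (1 + a * y) ^ (-(m / a)) ≤ (1 + b * y) ^ (-(m / b)) := by
  have hb : 0 < b := ha.trans_le hab
  have hay : 0 ≤ a * y := by positivity
  have hbern : 1 + b * y ≤ (1 + a * y) ^ (b / a) := by
    have h := one_add_mul_self_le_rpow_one_add (s := a * y) (by linarith)
      ((one_le_div ha).2 hab)
    rwa [← mul_assoc, div_mul_cancel₀ b ha.ne'] at h
  have hexp : -(m / a) = b / a * -(m / b) := by field_simp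
  rw [hexp, rpow_mul (by positivity)]
  exact rpow_le_rpow_of_nonpos (by positivity) hbern (neg_nonpos.2 (by positivity))

/-- For every integer `n ≥ 2` and every `t ≥ 1`, the upper bound
`(t+√(t²-1))^{n(2n²-1)/(2n²-n-2)} (t + (2n²-1)/(n+1) √(t²-1))^{-n(n+1)/(2n²-n-2)}`
for the Legendre polynomial `P_n(t)` is at most (i.e. stronger than) the bound
`(t+√(t²-1))^{n(2n-1)/(2(n-1))} (t + (2n-1)√(t²-1))^{-n/(2(n-1))}`. -/
theorem legendre_bound_comparison (n : ℕ) (hn : 2 ≤ n) :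
    ∀ t : ℝ, 1 ≤ t →
      (t + Real.sqrt (t ^ 2 - 1)) ^
          (((n : ℝ) * (2 * (n : ℝ) ^ 2 - 1)) / (2 * (n : ℝ) ^ 2 - (n : ℝ) - 2)) *
        (t + (2 * (n : ℝ) ^ 2 - 1) / ((n : ℝ) + 1) * Real.sqrt (t ^ 2 - 1)) ^
          (-(((n : ℝ) * ((n : ℝ) + 1)) / (2 * (n : ℝ) ^ 2 - (n : ℝ) - 2))) ≤
      (t + Real.sqrt (t ^ 2 - 1)) ^
          (((n : ℝ) * (2 * (n : ℝ) - 1)) / (2 * ((n : ℝ) - 1))) *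
        (t + (2 * (n : ℝ) - 1) * Real.sqrt (t ^ 2 - 1)) ^
          (-((n : ℝ) / (2 * ((n : ℝ) - 1)))) := by
  intro t ht
  have hn' : (2 : ℝ) ≤ n := by exact_mod_cast hn
  generalize (n : ℝ) = m at hn' ⊢
  have hs : 0 ≤ √(t ^ 2 - 1) := sqrt_nonneg _
  generalize √(t ^ 2 - 1) = s at hs ⊢
  have hu : 0 < t + s := by linarith
  have hden : 0 < 2 * m ^ 2 - m - 2 := by nlinarith
  have hm : 0 < m + 1 := by linarith
  have hb : 0 < 2 * (m - 1) := by linarith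
  have ha : 0 < (2 * m ^ 2 - m - 2) / (m + 1) := div_pos hden hm
  have hab : (2 * m ^ 2 - m - 2) / (m + 1) ≤ 2 * (m - 1) := by
    rw [div_le_iff₀ hm]
    nlinarith
  have key : (t + s) ^ (m * (1 + (2 * m ^ 2 - m - 2) / (m + 1)) / ((2 * m ^ 2 - m - 2) / (m + 1))) *
        (t + s + (2 * m ^ 2 - m - 2) / (m + 1) * s) ^ (-(m / ((2 * m ^ 2 - m - 2) / (m + 1)))) ≤
      (t + s) ^ (m * (1 + 2 * (m - 1)) / (2 * (m - 1))) *
        (t + s + 2 * (m - 1) * s) ^ (-(m / (2 * (m - 1)))) := by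
    rw [rpow_mul_add_rpow_eq hu hs ha, rpow_mul_add_rpow_eq hu hs hb]
    gcongr
    exact one_add_mul_rpow_neg_div_le (by positivity) (by linarith) ha hab
  have hadd : 1 + (2 * m ^ 2 - m - 2) / (m + 1) = (2 * m ^ 2 - 1) / (m + 1) := by
    field_simp
    ring
  convert key using 3
  · rw [hadd, mul_div_assoc, mul_div_assoc, div_div_div_cancel_right₀ hm.ne']
  · rw [← hadd]
    ring
  · rw [div_div_eq_mul_div]
  · ring
  · ring
end

section
/- Let $n$ be a positive integer. For every real $x \ge 0$, $\frac{2\exp\left(\sqrt{1+(4nx)^2}-1-4nx\right)}{\sqrt{1+(4nx)^2}+1} \le \frac{1}{4nx+1}$. -/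
open Real

/-- The claimed bound in the variable `t = 4nx`, with denominators cleared. -/
lemma two_mul_add_one_le_exp_mul_sqrt {t : ℝ} (ht : 0 ≤ t) :
    2 * (t + 1) ≤ Real.exp (t + 1 - √(1 + t ^ 2)) * (√(1 + t ^ 2) + 1) := by
  have hs : √(1 + t ^ 2) ^ 2 = 1 + t ^ 2 := Real.sq_sqrt (by positivity)
  have hs0 : 0 ≤ √(1 + t ^ 2) := Real.sqrt_nonneg _
  set s := √(1 + t ^ 2)
  have hst : s ≤ t + 1 := abs_le_of_sq_le_sq' (by nlinarith) (by linarith) |>.2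
  have hle : s * (1 + t) ≤ 1 + t + t ^ 2 :=
    abs_le_of_sq_le_sq' (by rw [mul_pow, hs]; nlinarith [sq_nonneg t]) (by positivity) |>.2
  have hexp := Real.quadratic_le_exp_of_nonneg (sub_nonneg.2 hst)
  refine le_trans ?_ (mul_le_mul_of_nonneg_right hexp (by linarith))
  have hmul : 0 ≤ s * (1 + t + t ^ 2 - s * (1 + t)) := mul_nonneg hs0 (by linarith)
  have key : (1 + (t + 1 - s) + (t + 1 - s) ^ 2 / 2) * (s + 1) - 2 * (t + 1)
      = s * (1 + t + t ^ 2 - s * (1 + t)) := by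
    linear_combination (s / 2 - 1 / 2) * hs
  linarith

/-- For every positive integer `n` and every real `x ≥ 0`,
`2 exp(√(1+(4nx)²) - 1 - 4nx) / (√(1+(4nx)²) + 1) ≤ 1/(4nx+1)`. -/
theorem bound_comparison_szasz (n : ℕ) (hn : 0 < n) :
    ∀ x : ℝ, 0 ≤ x →
      2 * Real.exp (Real.sqrt (1 + (4 * n * x) ^ 2) - 1 - 4 * n * x)
          / (Real.sqrt (1 + (4 * n * x) ^ 2) + 1)
        ≤ 1 / (4 * n * x + 1) := by
  intro x hx
  have ht : 0 ≤ 4 * (n : ℝ) * x := by positivity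
  generalize 4 * (n : ℝ) * x = t at ht ⊢
  have h := two_mul_add_one_le_exp_mul_sqrt ht
  rw [div_le_div_iff₀ (by positivity) (by positivity),
    show √(1 + t ^ 2) - 1 - t = -(t + 1 - √(1 + t ^ 2)) by ring, Real.exp_neg]
  calc 2 * (Real.exp (t + 1 - √(1 + t ^ 2)))⁻¹ * (t + 1)
      = 2 * (t + 1) / Real.exp (t + 1 - √(1 + t ^ 2)) := by ring
    _ ≤ 1 * (√(1 + t ^ 2) + 1) := by
      rw [div_le_iff₀ (Real.exp_pos _)]
      linarith
end

section
/- For every real $x \ge 0$, $\frac{2\exp\left(\sqrt{1+4x^2}-1\right)}{\sqrt{1+4x^2}+1} \le \frac{e^{2x}}{2x+1}$. -/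
open Real

/-- For every real `x ≥ 0`,
`2 exp(√(1+4x²) - 1) / (√(1+4x²) + 1) ≤ e^{2x}/(2x+1)`. -/
theorem bound_comparison_bessel :
    ∀ x : ℝ, 0 ≤ x →
      2 * Real.exp (Real.sqrt (1 + 4 * x ^ 2) - 1) / (Real.sqrt (1 + 4 * x ^ 2) + 1)
        ≤ Real.exp (2 * x) / (2 * x + 1) := by
  intro x hx
  have hsq : √(1 + 4 * x ^ 2) ^ 2 = 1 + 4 * x ^ 2 := Real.sq_sqrt (by positivity)
  have hs0 : 0 ≤ √(1 + 4 * x ^ 2) := Real.sqrt_nonneg _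
  generalize √(1 + 4 * x ^ 2) = s at hsq hs0 ⊢
  obtain ⟨d, rfl⟩ : ∃ d, s = 2 * x + 1 - d := ⟨2 * x + 1 - s, by ring⟩
  have hd1 : 0 < 1 - d := by nlinarith
  have hd0 : 0 ≤ d := by nlinarith
  have hpoly : 2 * (2 * x + 1) ≤ (1 + d + d ^ 2 / 2) * (2 * x + 1 - d + 1) := by
    have hx_eq : (2 * x + 1) * (2 * (1 - d)) = 2 - d ^ 2 := by linear_combination hsq
    have hs_eq : (2 * x + 1 - d + 1) * (2 * (1 - d)) = (2 - d) ^ 2 := by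
      linear_combination hsq
    refine le_of_mul_le_mul_right ?_ (by positivity : 0 < 2 * (1 - d))
    rw [mul_assoc, hx_eq, mul_assoc, hs_eq]
    nlinarith [mul_nonneg (sq_nonneg d) hd1.le, sq_nonneg (d ^ 2)]
  have hexp : Real.exp (2 * x) = Real.exp d * Real.exp (2 * x + 1 - d - 1) := by
    rw [← Real.exp_add]
    ring_nf
  rw [div_le_div_iff₀ (by linarith) (by linarith), hexp]
  have hle : 2 * (2 * x + 1) ≤ Real.exp d * (2 * x + 1 - d + 1) :=
    hpoly.trans <| mul_le_mul_of_nonneg_right (Real.quadratic_le_exp_of_nonneg hd0) (by linarith)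
  linear_combination Real.exp (2 * x + 1 - d - 1) * hle
end

section
/- Let $n$ be a positive integer. For every $t > 1$, $\frac{\sqrt{4n^2(t^2-1)+(t-\sqrt{t^2-1})^2}-(t-\sqrt{t^2-1})}{2(t^2-1)} \le \frac{2n^2}{t+(2n-1)\sqrt{t^2-1}}$. -/
open Real

/-- For every positive integer `n` and every `t > 1`,
`(√(4n²(t²-1) + (t-√(t²-1))²) - (t-√(t²-1))) / (2(t²-1)) ≤ 2n²/(t+(2n-1)√(t²-1))`. -/
theorem legendre_logderiv_bound_comparison (n : ℕ) (hn : 0 < n) :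
    ∀ t : ℝ, 1 < t →
      (Real.sqrt (4 * n ^ 2 * (t ^ 2 - 1) + (t - Real.sqrt (t ^ 2 - 1)) ^ 2)
          - (t - Real.sqrt (t ^ 2 - 1))) / (2 * (t ^ 2 - 1))
        ≤ 2 * n ^ 2 / (t + (2 * n - 1) * Real.sqrt (t ^ 2 - 1)) := by
  intro t ht
  have hpos : 0 < t ^ 2 - 1 := by nlinarith
  have hn' : (1 : ℝ) ≤ n := by exact_mod_cast hn
  set s := Real.sqrt (t ^ 2 - 1)
  have hs0 : 0 < s := Real.sqrt_pos.mpr hpos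
  have hss : s ^ 2 = t ^ 2 - 1 := Real.sq_sqrt hpos.le
  rw [← hss]
  set R := Real.sqrt (4 * n ^ 2 * s ^ 2 + (t - s) ^ 2)
  have hRR : R ^ 2 = 4 * n ^ 2 * s ^ 2 + (t - s) ^ 2 := Real.sq_sqrt (by positivity)
  have hR_ge : 2 * n * s ≤ R := Real.le_sqrt_of_sq_le (by nlinarith [sq_nonneg (t - s)])
  have hR_ge' : t - s ≤ R :=
    Real.le_sqrt_of_sq_le (le_add_of_nonneg_left (by positivity))
  have hden : 0 < t + (2 * n - 1) * s := by
    have : 0 < (2 * (n : ℝ) - 1) * s := mul_pos (by linarith) hs0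
    linarith
  rw [div_le_div_iff₀ (by positivity) hden]
  nlinarith [mul_nonneg (sub_nonneg.mpr hR_ge') (sub_nonneg.mpr hR_ge)]
end

section
/- Let $n$ be a positive integer and let $t > 1$. Then the inequality $\frac{\sqrt{4n^2(t^2-1)+(t-\sqrt{t^2-1})^2}-(t-\sqrt{t^2-1})}{2(t^2-1)} \le \frac{n^2(2n+1)}{(n+1)t+(2n^2-1)\sqrt{t^2-1}}$ holds if and only if $\frac{t}{t+\sqrt{t^2-1}} \ge \frac{3n+2}{4n+3}$. -/
open Real

/-- For a positive integer `n` and `t > 1`, the inequality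
`(√(4n²(t²-1) + (t-√(t²-1))²) - (t-√(t²-1))) / (2(t²-1)) ≤ n²(2n+1)/((n+1)t+(2n²-1)√(t²-1))`
holds if and only if `t/(t+√(t²-1)) ≥ (3n+2)/(4n+3)`. -/
theorem legendre_logderiv_bound_comparison_iff (n : ℕ) (hn : 0 < n) (t : ℝ) (ht : 1 < t) :
    ((Real.sqrt (4 * n ^ 2 * (t ^ 2 - 1) + (t - Real.sqrt (t ^ 2 - 1)) ^ 2)
          - (t - Real.sqrt (t ^ 2 - 1))) / (2 * (t ^ 2 - 1))
        ≤ n ^ 2 * (2 * n + 1) / ((n + 1) * t + (2 * n ^ 2 - 1) * Real.sqrt (t ^ 2 - 1)))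
      ↔ (3 * n + 2) / (4 * n + 3) ≤ t / (t + Real.sqrt (t ^ 2 - 1)) := by
  have hn1 : (1 : ℝ) ≤ n := by exact_mod_cast hn
  have hs2 : 0 < t ^ 2 - 1 := by nlinarith
  have hs : 0 < √(t ^ 2 - 1) := Real.sqrt_pos.2 hs2
  have hsq : √(t ^ 2 - 1) ^ 2 = t ^ 2 - 1 := Real.sq_sqrt hs2.le
  have hst : √(t ^ 2 - 1) < t := by nlinarith
  rw [← hsq, Real.sqrt_sq hs.le]
  clear hsq
  generalize √(t ^ 2 - 1) = s at hs hst ⊢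
  generalize (n : ℝ) = m at hn1 ⊢
  have hD : 0 < (m + 1) * t + (2 * m ^ 2 - 1) * s := by
    have : 0 < 2 * m ^ 2 - 1 := by nlinarith
    positivity
  set D := (m + 1) * t + (2 * m ^ 2 - 1) * s with hDdef
  have hR : 0 ≤ m ^ 2 * (2 * m + 1) / D := by positivity
  have hkey : (t - s + m ^ 2 * (2 * m + 1) / D * (2 * s ^ 2)) ^ 2
      - (4 * m ^ 2 * s ^ 2 + (t - s) ^ 2)
      = 4 * s ^ 2 * m ^ 3 * (t - s) / D ^ 2 * ((m + 1) * t - (3 * m + 2) * s) := by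
    field_simp
    rw [hDdef]
    ring
  have hc : 0 < 4 * s ^ 2 * m ^ 3 * (t - s) / D ^ 2 := by
    have := sub_pos.2 hst
    positivity
  have hB : 0 ≤ t - s + m ^ 2 * (2 * m + 1) / D * (2 * s ^ 2) := by
    have := sub_pos.2 hst
    positivity
  rw [div_le_iff₀ (by positivity), sub_le_iff_le_add', Real.sqrt_le_left hB, ← sub_nonneg, hkey,
    mul_nonneg_iff_of_pos_left hc, div_le_div_iff₀ (by linarith) (by linarith)]
  constructor <;> intro h <;> linarith
end

section
/- Let $n$ be a positive integer, let $y \in [0,1)$ be fixed, and let $x \in [0,1-y]$. Then $R_n(x,y) = \sum_{j=0}^{n} \binom{n}{j}^2 y^{2j}(1-y)^{2(n-j)} F_{n-j}\left(\frac{x}{1-y}\right)$. -/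
open Real Set

/-- `R n x y = ∑_{i+j≤n} (n!/(i!j!(n-i-j)!))² x^{2i} y^{2j} (1-x-y)^{2(n-i-j)}`, the sum of
the squares of the bivariate Bernstein basis polynomials on the canonical simplex of `ℝ²`. -/
noncomputable def bernsteinR (n : ℕ) (x y : ℝ) : ℝ :=
  ∑ j ∈ Finset.range (n + 1), ∑ i ∈ Finset.range (n + 1 - j),
    ((Nat.factorial n : ℝ) /
        ((Nat.factorial i : ℝ) * (Nat.factorial j : ℝ) * (Nat.factorial (n - i - j) : ℝ))) ^ 2 *
      x ^ (2 * i) * y ^ (2 * j) * (1 - x - y) ^ (2 * (n - i - j))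

/-- A trinomial coefficient is a product of two binomial coefficients. -/
theorem factorial_div_eq_choose_mul_choose (i j k : ℕ) :
    ((i + j + k).factorial : ℝ) / (i.factorial * j.factorial * k.factorial) =
      (i + j + k).choose j * (i + k).choose i := by
  rw [show i + j + k = j + (i + k) by ring, Nat.cast_add_choose, Nat.cast_add_choose]
  field_simp

/-- The homogeneous form of `bernsteinF`. -/
theorem pow_mul_bernsteinF_div (m : ℕ) (x : ℝ) {t : ℝ} (ht : t ≠ 0) :
    t ^ (2 * m) * bernsteinF m (x / t) =
      ∑ i ∈ Finset.range (m + 1),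
        (m.choose i : ℝ) ^ 2 * x ^ (2 * i) * (t - x) ^ (2 * (m - i)) := by
  rw [bernsteinF, Finset.mul_sum]
  refine Finset.sum_congr rfl fun i hi => ?_
  obtain ⟨k, rfl⟩ := Nat.exists_eq_add_of_le (Finset.mem_range_succ_iff.mp hi)
  rw [Nat.add_sub_cancel_left, one_sub_div ht, div_pow, div_pow, mul_add, pow_add]
  field_simp

/-- For a positive integer `n`, `y ∈ [0,1)` and `x ∈ [0,1-y]`,
`R_n(x,y) = ∑_{j=0}^n C(n,j)² y^{2j} (1-y)^{2(n-j)} F_{n-j}(x/(1-y))`. -/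
theorem bernsteinR_decomposition (n : ℕ) (hn : 0 < n) (y : ℝ) (hy : y ∈ Ico (0 : ℝ) 1)
    (x : ℝ) (hx : x ∈ Icc (0 : ℝ) (1 - y)) :
    bernsteinR n x y =
      ∑ j ∈ Finset.range (n + 1),
        (Nat.choose n j : ℝ) ^ 2 * y ^ (2 * j) * (1 - y) ^ (2 * (n - j)) *
          bernsteinF (n - j) (x / (1 - y)) := by
  have ht : 1 - y ≠ 0 := (sub_pos.mpr hy.2).ne'
  refine Finset.sum_congr rfl fun j hj => ?_
  rw [mul_assoc, pow_mul_bernsteinF_div _ _ ht, Finset.mul_sum,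
    Nat.sub_add_comm (Finset.mem_range_succ_iff.mp hj)]
  refine Finset.sum_congr rfl fun i hi => ?_
  obtain ⟨k, rfl⟩ : ∃ k, n = i + j + k :=
    Nat.exists_eq_add_of_le (by simp only [Finset.mem_range] at hi hj; omega)
  rw [show i + j + k - i - j = k by omega, show i + j + k - j = i + k by omega,
    Nat.add_sub_cancel_left, factorial_div_eq_choose_mul_choose, sub_right_comm]
  ring
end

section
/- Let $n$ be a positive integer and let $y \in [0,1)$ be fixed. Then the function $x \mapsto R_n(x,y)$ is convex on the interval $[0, 1-y]$. -/
open Real Set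

/-- Discrete Parseval identity for a polynomial with real coefficients, sampled at the `N`-th
roots of unity. -/
theorem sum_norm_sq_sum_mul_pow_primitiveRoot {N : ℕ} {ζ : ℂ} (hζ : IsPrimitiveRoot ζ N)
    (c : ℕ → ℝ) :
    ∑ r ∈ Finset.range N, ‖∑ k ∈ Finset.range N, (c k : ℂ) * (ζ ^ r) ^ k‖ ^ 2 =
      N * ∑ k ∈ Finset.range N, c k ^ 2 := by
  rcases Nat.eq_zero_or_pos N with rfl | hN
  · simp
  have hne : ζ ≠ 0 := hζ.ne_zero hN.ne'
  have hconj : (starRingEnd ℂ) ζ = ζ⁻¹ :=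
    (Complex.inv_eq_conj (hζ.norm'_eq_one hN.ne')).symm
  have orth : ∀ k ∈ Finset.range N, ∀ l ∈ Finset.range N,
      ∑ r ∈ Finset.range N, (ζ ^ k * (ζ⁻¹) ^ l) ^ r = if k = l then (N : ℂ) else 0 := by
    intro k hk l hl
    split_ifs with h
    · subst h
      simp [hne]
    · have h1 : ζ ^ k * (ζ⁻¹) ^ l ≠ 1 := by
        intro h1
        refine h (hζ.pow_inj (Finset.mem_range.1 hk) (Finset.mem_range.1 hl) ?_)
        rwa [inv_pow, mul_inv_eq_one₀ (pow_ne_zero _ hne)] at h1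
      rw [geom_sum_eq h1, mul_pow, ← pow_mul, ← pow_mul, mul_comm k, mul_comm l, pow_mul,
        pow_mul, inv_pow ζ, hζ.pow_eq_one]
      simp
  have key : ∑ r ∈ Finset.range N, ((‖∑ k ∈ Finset.range N, (c k : ℂ) * (ζ ^ r) ^ k‖ : ℂ)) ^ 2 =
      N * ∑ k ∈ Finset.range N, (c k : ℂ) ^ 2 := by
    calc _ = ∑ r ∈ Finset.range N, ∑ k ∈ Finset.range N, ∑ l ∈ Finset.range N,
          (c k : ℂ) * c l * (ζ ^ k * (ζ⁻¹) ^ l) ^ r := by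
          refine Finset.sum_congr rfl fun r _ => ?_
          rw [← Complex.mul_conj', map_sum, Finset.sum_mul_sum]
          refine Finset.sum_congr rfl fun k _ => Finset.sum_congr rfl fun l _ => ?_
          simp only [map_mul, map_pow, Complex.conj_ofReal, hconj]
          ring
      _ = ∑ k ∈ Finset.range N, ∑ l ∈ Finset.range N, (c k : ℂ) * c l *
          ∑ r ∈ Finset.range N, (ζ ^ k * (ζ⁻¹) ^ l) ^ r := by
          rw [Finset.sum_comm]
          refine Finset.sum_congr rfl fun k _ => ?_
          rw [Finset.sum_comm]
          simp only [Finset.mul_sum]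
      _ = _ := by
          rw [Finset.mul_sum]
          refine Finset.sum_congr rfl fun k hk => ?_
          rw [Finset.sum_congr rfl fun l hl => by rw [orth k hk l hl]]
          simp only [mul_ite, mul_zero, Finset.sum_ite_eq, if_pos hk]
          ring
  exact_mod_cast key

/-- The sum of squares of the terms of the binomial expansion of `(a + b) ^ m` is the mean of
`‖a ζ ^ r + b‖ ^ (2 * m)` over the `(m + 1)`-th roots of unity. -/
theorem sum_choose_sq_eq_mean {m : ℕ} {ζ : ℂ} (hζ : IsPrimitiveRoot ζ (m + 1)) (a b : ℝ) :
    ∑ k ∈ Finset.range (m + 1), (m.choose k : ℝ) ^ 2 * a ^ (2 * k) * b ^ (2 * (m - k)) =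
      ((m : ℝ) + 1)⁻¹ * ∑ r ∈ Finset.range (m + 1), ‖(a : ℂ) * ζ ^ r + b‖ ^ (2 * m) := by
  have h := sum_norm_sq_sum_mul_pow_primitiveRoot hζ
    fun k => (m.choose k : ℝ) * a ^ k * b ^ (m - k)
  have h1 : ∀ r, ∑ k ∈ Finset.range (m + 1),
      (((m.choose k : ℝ) * a ^ k * b ^ (m - k) : ℝ) : ℂ) * (ζ ^ r) ^ k =
        ((a : ℂ) * ζ ^ r + b) ^ m := by
    intro r
    rw [add_pow]
    refine Finset.sum_congr rfl fun k _ => ?_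
    push_cast
    ring
  simp only [h1, norm_pow] at h
  simp only [← pow_mul, mul_comm m 2] at h
  rw [h, Nat.cast_succ, inv_mul_cancel_left₀ (by positivity)]
  refine Finset.sum_congr rfl fun k _ => ?_
  ring

/-- The sum of squares of the Bernstein polynomials of degree `m`, homogenized, is convex. -/
theorem convexOn_sum_choose_sq (m : ℕ) (s : ℝ) :
    ConvexOn ℝ univ fun x : ℝ => ∑ k ∈ Finset.range (m + 1),
      (m.choose k : ℝ) ^ 2 * x ^ (2 * k) * (s - x) ^ (2 * (m - k)) := by
  have hζ := Complex.isPrimitiveRoot_exp (m + 1) m.succ_ne_zero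
  simp only [sum_choose_sq_eq_mean hζ]
  set ζ := Complex.exp (2 * π * Complex.I / (m + 1 : ℕ))
  have hnorm : ∀ r, ConvexOn ℝ univ fun x : ℝ => ‖(x : ℂ) * ζ ^ r + (s - x : ℝ)‖ := by
    intro r
    refine ⟨convex_univ, fun x _ y _ a b ha hb hab => ?_⟩
    have hs : (s : ℂ) = a * s + b * s := by
      rw [← add_mul, ← Complex.ofReal_add, hab, Complex.ofReal_one, one_mul]
    have : ((a • x + b • y : ℝ) : ℂ) * ζ ^ r + (s - (a • x + b • y) : ℝ) =
        a • ((x : ℂ) * ζ ^ r + (s - x : ℝ)) + b • ((y : ℂ) * ζ ^ r + (s - y : ℝ)) := by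
      simp only [smul_eq_mul, Complex.real_smul]
      push_cast
      linear_combination hs
    simp only [this]
    refine (norm_add_le _ _).trans_eq ?_
    rw [norm_smul, norm_smul, Real.norm_of_nonneg ha, Real.norm_of_nonneg hb, smul_eq_mul,
      smul_eq_mul]
  have hsum : ∀ t : Finset ℕ, ConvexOn ℝ univ fun x : ℝ =>
      ∑ r ∈ t, ‖(x : ℂ) * ζ ^ r + (s - x : ℝ)‖ ^ (2 * m) := by
    intro t
    induction t using Finset.induction_on with
    | empty => simpa using convexOn_const (0 : ℝ) convex_univ
    | insert r t hr ih =>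
      simp only [Finset.sum_insert hr]
      exact ((hnorm r).pow (fun _ _ => norm_nonneg _) _).add ih
  exact (hsum _).smul (by positivity)

/-- Grouping the terms of `bernsteinR n x y` by the exponent of `y`. -/
theorem bernsteinR_eq_sum (n : ℕ) (x y : ℝ) :
    bernsteinR n x y = ∑ j ∈ Finset.range (n + 1), ((n.choose j : ℝ) * y ^ j) ^ 2 *
      ∑ k ∈ Finset.range (n - j + 1),
        ((n - j).choose k : ℝ) ^ 2 * x ^ (2 * k) * (1 - y - x) ^ (2 * (n - j - k)) := by
  refine Finset.sum_congr rfl fun j hj => ?_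
  have hjn : j ≤ n := Nat.lt_succ_iff.1 (Finset.mem_range.1 hj)
  rw [Finset.mul_sum, Nat.succ_sub hjn]
  refine Finset.sum_congr rfl fun i hi => ?_
  have hin : i ≤ n - j := Nat.lt_succ_iff.1 (Finset.mem_range.1 hi)
  rw [Nat.cast_choose ℝ hjn, Nat.cast_choose ℝ hin, Nat.sub_right_comm n i j,
    sub_right_comm 1 x y]
  have := Nat.cast_ne_zero (R := ℝ).2 (n - j).factorial_ne_zero
  field_simp
  ring

/-- For a positive integer `n` and fixed `y ∈ [0,1)`, the function
`x ↦ R_n(x,y)` is convex on `[0,1-y]`. -/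
theorem bernsteinR_convex_in_x (n : ℕ) (hn : 0 < n) (y : ℝ) (hy : y ∈ Ico (0 : ℝ) 1) :
    ConvexOn ℝ (Icc (0 : ℝ) (1 - y)) (fun x => bernsteinR n x y) := by
  simp only [bernsteinR_eq_sum]
  have hsum : ∀ t : Finset ℕ, ConvexOn ℝ univ fun x : ℝ =>
      ∑ j ∈ t, ((n.choose j : ℝ) * y ^ j) ^ 2 * ∑ k ∈ Finset.range (n - j + 1),
        ((n - j).choose k : ℝ) ^ 2 * x ^ (2 * k) * (1 - y - x) ^ (2 * (n - j - k)) := by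
    intro t
    induction t using Finset.induction_on with
    | empty => simpa using convexOn_const (0 : ℝ) convex_univ
    | insert j t hj ih =>
      simp only [Finset.sum_insert hj]
      exact ((convexOn_sum_choose_sq (n - j) (1 - y)).smul (sq_nonneg _)).add ih
  exact (hsum _).subset (subset_univ _) (convex_Icc _ _)
end

section
/- Let $n$ be a positive integer and let $x > 0$. Then $\int_0^\infty \left(\frac{n^n}{x^n (n-1)!}\, t^{n-1} e^{-nt/x}\right)^2 dt = \binom{2n-2}{n-1} 2^{1-2n}\, \frac{n}{x}$; that is, the function $S_n$ associated with the Post–Widder operators equals $\binom{2n-2}{n-1} 2^{1-2n}\, n/x$ for $x > 0$. -/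
open Real Set MeasureTheory

theorem integral_pow_mul_exp_neg_mul_Ioi (k : ℕ) {r : ℝ} (hr : 0 < r) :
    ∫ t in Ioi (0 : ℝ), t ^ k * Real.exp (-(r * t)) = (1 / r) ^ (k + 1) * (k.factorial : ℝ) := by
  have h := Real.integral_rpow_mul_exp_neg_mul_Ioi (a := (k : ℝ) + 1) (by positivity) hr
  rw [Real.Gamma_nat_eq_factorial, add_sub_cancel_right] at h
  simpa only [Real.rpow_natCast, ← Nat.cast_add_one] using h

/-- For the Post–Widder kernel
`K_n(x,t) = nⁿ/(xⁿ(n-1)!) tⁿ⁻¹ e^{-nt/x}`, one has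
`∫_0^∞ K_n(x,t)² dt = C(2n-2, n-1) 2^{1-2n} n/x` for every `x > 0`;
this is the function `S_n` associated with the Post–Widder operators. -/
theorem postWidder_S_eq (n : ℕ) (hn : 0 < n) (x : ℝ) (hx : 0 < x) :
    ∫ t in Ioi (0 : ℝ),
        ((n : ℝ) ^ n / (x ^ n * (Nat.factorial (n - 1) : ℝ)) * t ^ (n - 1) *
          Real.exp (-(n : ℝ) * t / x)) ^ 2
      = (Nat.choose (2 * n - 2) (n - 1) : ℝ) * (2 : ℝ) ^ ((1 : ℤ) - 2 * n) * n / x := by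
  obtain ⟨m, rfl⟩ : ∃ m, n = m + 1 := ⟨n - 1, by omega⟩
  have hexp : (1 : ℤ) - 2 * ((m + 1 : ℕ) : ℤ) = -((2 * m + 1 : ℕ) : ℤ) := by
    push_cast; ring
  have hchoose : ((2 * m).choose m : ℝ) * m.factorial * m.factorial = (2 * m).factorial := by
    have h := Nat.choose_mul_factorial_mul_factorial (show m ≤ 2 * m by omega)
    rw [show 2 * m - m = m by omega] at h
    exact_mod_cast h
  rw [hexp, zpow_neg, zpow_natCast, show 2 * (m + 1) - 2 = 2 * m by omega, Nat.add_sub_cancel]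
  have hN : (0 : ℝ) < ((m + 1 : ℕ) : ℝ) := by positivity
  generalize ((m + 1 : ℕ) : ℝ) = N at hN ⊢
  have hintegrand : ∀ t : ℝ,
      (N ^ (m + 1) / (x ^ (m + 1) * (m.factorial : ℝ)) * t ^ m * Real.exp (-N * t / x)) ^ 2 =
        (N ^ (m + 1) / (x ^ (m + 1) * (m.factorial : ℝ))) ^ 2 *
          (t ^ (2 * m) * Real.exp (-(2 * N / x * t))) := by
    intro t
    rw [mul_pow, mul_pow, ← Real.exp_nat_mul, ← pow_mul, mul_comm m 2, mul_assoc]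
    congr 3
    push_cast
    ring
  simp_rw [hintegrand]
  rw [integral_const_mul, integral_pow_mul_exp_neg_mul_Ioi (2 * m) (by positivity), ← hchoose]
  have hfact : (m.factorial : ℝ) ≠ 0 := by positivity
  simp only [one_div, inv_div, div_pow, mul_pow]
  field_simp
  ring
end
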